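/- Let C be the set of cubic forms f ∈ ℂ[x₀,…,x₅] that are apolar to some Veronese surface, i.e., such that there exists A ∈ GL₆(ℂ) with ⟨f,k⟩ = 0 for every cubic form k vanishing identically on the cone A·ν(ℂ³). Then the vanishing ideal of C (in the polynomial ring on the 56 coefficients of a cubic form in 6 variables) is a prime ideal of height 1; equivalently, the Zariski closure of C is an irreducible hypersurface in the 56-dimensional space of cubic forms. (Corollary \ref{codim1} of the paper: the cubic forms apolar to some Veronese surface form a hypersurface D_{V-ap}.) -/

import Mathlib

open MvPolynomial

/-- The constant-coefficient differential operator associated with the monomial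
exponent `d`: the composition over `i` of `(∂/∂xᵢ)^(d i)`. -/
noncomputable def monOp {n : ℕ} (d : Fin n →₀ ℕ) :
    Module.End ℂ (MvPolynomial (Fin n) ℂ) :=
  (List.ofFn fun i : Fin n =>
    ((pderiv (R := ℂ) i).toLinearMap : Module.End ℂ (MvPolynomial (Fin n) ℂ)) ^ (d i)).prod

/-- The apolarity action `g ∘ f` : apply `g`, viewed as a constant-coefficient
differential operator, to `f`. -/
noncomputable def apolar {n : ℕ} (g f : MvPolynomial (Fin n) ℂ) :
    MvPolynomial (Fin n) ℂ :=
  ∑ d ∈ g.support, coeff d g • monOp d f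

/-- The apolarity pairing `⟨f, k⟩ := k ∘ f` (its constant term). -/
noncomputable def pairing {n : ℕ} (f k : MvPolynomial (Fin n) ℂ) : ℂ :=
  eval (fun _ => (0 : ℂ)) (apolar k f)

/-- The linear form `Σ vᵢ xᵢ` associated with a vector `v`. -/
noncomputable def linForm {n : ℕ} (v : Fin n → ℂ) : MvPolynomial (Fin n) ℂ :=
  ∑ i, MvPolynomial.C (v i) * X i

/-- The directional partial derivative `∂_v f = Σ vᵢ ∂f/∂xᵢ`. -/
noncomputable def pdir {n : ℕ} (v : Fin n → ℂ) (f : MvPolynomial (Fin n) ℂ) :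
    MvPolynomial (Fin n) ℂ :=
  ∑ i, MvPolynomial.C (v i) * pderiv i f

/-- The Veronese map `ν : ℂ³ → ℂ⁶`. -/
noncomputable def nu (w : Fin 3 → ℂ) : Fin 6 → ℂ :=
  ![w 0 ^ 2, 2 * w 0 * w 1, 2 * w 0 * w 2, w 1 ^ 2, 2 * w 1 * w 2, w 2 ^ 2]

/-- The components of the Veronese map as quadratic forms in `y₀, y₁, y₂`. -/
noncomputable def nuPoly : Fin 6 → MvPolynomial (Fin 3) ℂ :=
  ![X 0 ^ 2, 2 * X 0 * X 1, 2 * X 0 * X 2, X 1 ^ 2, 2 * X 1 * X 2, X 2 ^ 2]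

/-- A quadratic form `q` in 6 variables has rank `≤ r`: there is a symmetric matrix
`M` of rank `≤ r` with `q(x) = xᵀ M x`. -/
def QuadRankLe (q : MvPolynomial (Fin 6) ℂ) (r : ℕ) : Prop :=
  ∃ M : Matrix (Fin 6) (Fin 6) ℂ, M.IsSymm ∧ M.rank ≤ r ∧
    ∀ x : Fin 6 → ℂ, eval x q = ∑ i, ∑ j, M i j * x i * x j

/-- `s` is the linear map carrying a ternary sextic `g` to the cubic `s(g)` in six
variables, characterized by `⟨s(g), k⟩ = ⟨g, m(k)⟩` for all cubic forms `k`, where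
`m(k) = k ∘ ν`. -/
def IsSMap (s : MvPolynomial (Fin 3) ℂ →ₗ[ℂ] MvPolynomial (Fin 6) ℂ) : Prop :=
  (∀ g : MvPolynomial (Fin 3) ℂ, g.IsHomogeneous 6 → (s g).IsHomogeneous 3) ∧
  ∀ g : MvPolynomial (Fin 3) ℂ, ∀ k : MvPolynomial (Fin 6) ℂ,
    g.IsHomogeneous 6 → k.IsHomogeneous 3 →
      pairing (s g) k = pairing g (aeval nuPoly k)

/-- Evaluation of a polynomial function `P` in the coefficients at a polynomial `g`. -/
noncomputable def evalCoeff {σ : Type} (g : MvPolynomial σ ℂ) (P : MvPolynomial (σ →₀ ℕ) ℂ) : ℂ :=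
  eval (fun d => coeff d g) P

/-- The vanishing ideal of a subset of `ℂ⁵⁶`. -/
noncomputable def vanishingIdealOf (S : Set (Fin 56 → ℂ)) : Ideal (MvPolynomial (Fin 56) ℂ) :=
  ⨅ x ∈ S, RingHom.ker (eval x)

/-- An ideal is a prime ideal of height one: it is prime, admits a prime strictly
below it, and admits no chain of two primes strictly below it. -/
def IsHeightOnePrime {R : Type*} [CommRing R] (I : Ideal R) : Prop :=
  I.IsPrime ∧ (∃ p : Ideal R, p.IsPrime ∧ p < I) ∧
    ∀ p q : Ideal R, p.IsPrime → q.IsPrime → p < q → ¬ q < I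

/-- The space `Q_{f,U}` of quadratic forms vanishing on `U` and apolar to `f`. -/
def QfU (f : MvPolynomial (Fin 6) ℂ) (U : Submodule ℂ (Fin 6 → ℂ)) :
    Set (MvPolynomial (Fin 6) ℂ) :=
  {q | q.IsHomogeneous 2 ∧ (∀ u ∈ U, eval u q = 0) ∧ apolar q f = 0}

/-- The Zariski closure of a subset of `ℂ⁵⁶`. -/
def zcl (S : Set (Fin 56 → ℂ)) : Set (Fin 56 → ℂ) :=
  {x | ∀ P : MvPolynomial (Fin 56) ℂ, (∀ y ∈ S, eval y P = 0) → eval x P = 0}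

/-- The projection of a polynomial onto its squarefree monomials. -/
noncomputable def sqfreeProj (f : MvPolynomial (Fin 6) ℂ) : MvPolynomial (Fin 6) ℂ :=
  ∑ d ∈ f.support.filter (fun d => ∀ i, d i ≤ 1), monomial d (coeff d f)

open Topology

/-- Evaluation of a polynomial is a smooth function of the point. -/
theorem contDiff_eval_mvPolynomial {σ : Type*} [Fintype σ] (P : MvPolynomial σ ℂ) :
    ContDiff ℂ 1 fun x : σ → ℂ => eval x P := by
  induction P using MvPolynomial.induction_on with
  | C a => simpa using contDiff_const
  | add p q hp hq => simpa using hp.add hq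
  | mul_X p i hp => simpa using hp.mul (contDiff_apply ℂ ℂ i)

/-- A polynomial vanishing near a point vanishes identically. -/
theorem MvPolynomial.eq_zero_of_eventually_eval_eq_zero {σ : Type*} [Fintype σ]
    {P : MvPolynomial σ ℂ} {y : σ → ℂ} (h : ∀ᶠ z in 𝓝 y, eval z P = 0) : P = 0 := by
  obtain ⟨ε, hε, hball⟩ := Metric.eventually_nhds_iff_ball.1 h
  refine MvPolynomial.funext_set (fun i => Metric.ball (y i) ε)
    (fun i => infinite_of_mem_nhds (y i) (Metric.ball_mem_nhds _ hε)) fun x hx => ?_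
  rw [map_zero]
  refine hball x ?_
  rw [ball_pi y hε]
  exact hx

/-- A polynomial that vanishes on the image of a map which is a submersion at some point
is zero. Surjectivity of the derivative is tested on linear functionals. -/
theorem MvPolynomial.eq_zero_of_submersion {E σ : Type*} [NormedAddCommGroup E]
    [NormedSpace ℂ E] [CompleteSpace E] [Fintype σ] {F : E → σ → ℂ} {x₀ : E}
    (hF : ContDiffAt ℂ 1 F x₀)
    (hsurj : ∀ c : σ → ℂ,
      (∀ v : E, deriv (fun t : ℂ => ∑ i, c i * F (x₀ + t • v) i) 0 = 0) → c = 0)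
    {P : MvPolynomial σ ℂ} (hP : ∀ᶠ x in 𝓝 x₀, eval (F x) P = 0) : P = 0 := by
  have hs := hF.hasStrictFDerivAt one_ne_zero
  set F' := fderiv ℂ F x₀ with hF'
  have hder : ∀ (c : σ → ℂ) (v : E),
      deriv (fun t : ℂ => ∑ i, c i * F (x₀ + t • v) i) 0 = ∑ i, c i * F' v i := by
    intro c v
    have hl : HasDerivAt (fun t : ℂ => x₀ + t • v) v 0 := by
      simpa using ((hasDerivAt_id (0 : ℂ)).smul_const v).const_add x₀
    have hs' : HasFDerivAt F F' (x₀ + (0 : ℂ) • v) := by simpa using hs.hasFDerivAt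
    have hc := hasDerivAt_pi.1 (hs'.comp_hasDerivAt (0 : ℂ) hl)
    exact (HasDerivAt.fun_sum fun i _ => (hc i).const_mul (c i)).deriv
  have hr : F'.range = ⊤ := by
    by_contra hne
    obtain ⟨g, hg0, hg⟩ := Submodule.exists_le_ker_of_lt_top _ (lt_top_iff_ne_top.2 hne)
    classical
    refine hg0 (LinearMap.pi_ext' fun i => ?_)
    have hc := hsurj (fun i => g (Pi.single i 1)) fun v => by
      rw [hder]
      have h0 : g (F' v) = 0 := hg ⟨v, rfl⟩
      rw [pi_eq_sum_univ' (F' v), map_sum] at h0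
      simpa [mul_comm] using h0
    ext
    simpa using congrFun hc i
  refine MvPolynomial.eq_zero_of_eventually_eval_eq_zero (y := F x₀) ?_
  rw [← hs.map_nhds_eq_of_surj hr]
  exact hP

/-- Over a domain `A`, primes of `A[X]` contracting to zero
have height at most one. -/
theorem Polynomial.not_lt_of_comap_C_eq_bot {A : Type*} [CommRing A] [IsDomain A]
    {I p q : Ideal (Polynomial A)} (hI : I.IsPrime) (hbot : I.comap Polynomial.C = ⊥)
    (hq : q.IsPrime) (hpq : p < q) : ¬ q < I := by
  intro hqI
  let K := FractionRing A
  let := Polynomial.algebra A K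
  have := Polynomial.isLocalization (nonZeroDivisors A) K
  have hdisj : ∀ J : Ideal (Polynomial A), J ≤ I →
      Disjoint ((nonZeroDivisors A).map Polynomial.C : Set (Polynomial A)) J := by
    intro J hJ
    rw [Set.disjoint_left]
    rintro _ ⟨a, ha, rfl⟩ hx
    have : a ∈ I.comap Polynomial.C := hJ hx
    rw [hbot, Ideal.mem_bot] at this
    exact nonZeroDivisors.ne_zero ha this
  let M := (nonZeroDivisors A).map (Polynomial.C : A →+* Polynomial A)
  let o := IsLocalization.orderIsoOfPrime M (Polynomial K)
  let q' := o.symm ⟨q, hq, hdisj q hqI.le⟩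
  let I' := o.symm ⟨I, hI, hdisj I le_rfl⟩
  have hlt : q' < I' := o.symm.lt_iff_lt.2 hqI
  have hq'0 : q'.1 ≠ ⊥ := by
    intro h0
    have h1 : q = q'.1.comap (algebraMap (Polynomial A) (Polynomial K)) :=
      (congrArg Subtype.val (o.apply_symm_apply ⟨q, hq, hdisj q hqI.le⟩)).symm
    have h2 : Function.Injective (algebraMap (Polynomial A) (Polynomial K)) :=
      Polynomial.map_injective _ (IsFractionRing.injective A K)
    rw [h0, ← RingHom.ker_eq_comap_bot, (RingHom.injective_iff_ker_eq_bot _).1 h2] at h1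
    exact not_lt_bot (h1 ▸ hpq)
  have := q'.2
  have hmax : q'.1.IsMaximal := IsPrime.to_maximal_ideal hq'0
  exact I'.2.ne_top (hmax.1.2 _ hlt)

/-- A prime ideal of a polynomial ring which contains no nonzero polynomial independent of
one given variable has height at most one. -/
theorem MvPolynomial.not_lt_of_rename_eq_zero {σ k : Type*} [Field k] (i : σ)
    {I p q : Ideal (MvPolynomial σ k)} (hI : I.IsPrime)
    (hbot : ∀ Q : MvPolynomial {j // j ≠ i} k, rename Subtype.val Q ∈ I → Q = 0)
    (hq : q.IsPrime) (hpq : p < q) : ¬ q < I := by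
  classical
  intro hqI
  let ε : MvPolynomial σ k ≃ₐ[k] Polynomial (MvPolynomial {j // j ≠ i} k) :=
    (renameEquiv k (Equiv.optionSubtypeNe i).symm).trans (optionEquivLeft k _)
  have hεsymm : ∀ Q, ε.symm (Polynomial.C Q) = rename Subtype.val Q := by
    intro Q
    rw [AlgEquiv.symm_apply_eq]
    induction Q using MvPolynomial.induction_on with
    | C a => simp [ε]
    | add p q hp hq => simp [hp, hq]
    | mul_X p j hp =>
      rw [map_mul, map_mul, map_mul, hp, rename_X]
      simp [ε, j.2]
  have hmono : ∀ J J' : Ideal (MvPolynomial σ k), J < J' →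
      J.comap ε.symm.toRingEquiv < J'.comap ε.symm.toRingEquiv := by
    intro J J' hJ
    refine lt_of_le_of_ne (Ideal.comap_mono hJ.le) fun heq => hJ.ne ?_
    exact Ideal.comap_injective_of_surjective _ ε.symm.surjective heq
  refine Polynomial.not_lt_of_comap_C_eq_bot (hI.comap ε.symm.toRingEquiv) ?_
    (hq.comap ε.symm.toRingEquiv) (hmono _ _ hpq) (hmono _ _ hqI)
  rw [eq_bot_iff]
  intro Q hQ
  refine hbot Q ?_
  rw [← hεsymm]
  exact hQ

/-- Evaluation of a polynomial after substitution. -/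
theorem MvPolynomial.eval_aeval_mvPolynomial {σ τ : Type*} (x : σ → ℂ)
    (g : τ → MvPolynomial σ ℂ) (P : MvPolynomial τ ℂ) :
    eval x (aeval g P) = eval (fun j => eval x (g j)) P := by
  induction P using MvPolynomial.induction_on with
  | C a => simp
  | add p q hp hq => rw [map_add, map_add, map_add, hp, hq]
  | mul_X p j hp => rw [map_mul, map_mul, map_mul, hp, aeval_X, eval_X]

/-- The substitution attached to a linear map of coordinate spaces. -/
theorem MvPolynomial.exists_algHom_eval {σ τ : Type*} [Fintype σ]
    (L : (σ → ℂ) →ₗ[ℂ] (τ → ℂ)) :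
    ∃ f : MvPolynomial τ ℂ →ₐ[ℂ] MvPolynomial σ ℂ, ∀ x P, eval x (f P) = eval (L x) P := by
  classical
  refine ⟨aeval fun j => ∑ i, C (L (Pi.single i 1) j) * X i, fun x P => ?_⟩
  rw [eval_aeval_mvPolynomial]
  congr 2
  funext j
  conv_rhs => rw [pi_eq_sum_univ' x, map_sum]
  simp [mul_comm]

/-- The change of variables attached to a linear isomorphism of coordinate spaces. -/
theorem MvPolynomial.exists_algEquiv_eval {σ τ : Type*} [Fintype σ] [Fintype τ]
    (L : (σ → ℂ) ≃ₗ[ℂ] (τ → ℂ)) :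
    ∃ ε : MvPolynomial τ ℂ ≃ₐ[ℂ] MvPolynomial σ ℂ,
      ∀ x P, eval x (ε P) = eval (L x) P := by
  obtain ⟨f, hf⟩ := exists_algHom_eval L.toLinearMap
  obtain ⟨g, hg⟩ := exists_algHom_eval L.symm.toLinearMap
  refine ⟨AlgEquiv.ofAlgHom f g ?_ ?_, hf⟩
  · refine AlgHom.ext fun P => MvPolynomial.funext fun x => ?_
    simp [hf, hg]
  · refine AlgHom.ext fun P => MvPolynomial.funext fun x => ?_
    simp [hf, hg]

/-- The exponents of degree `k` in `n` variables. -/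
abbrev Expo (n k : ℕ) : Type := {d : Fin n →₀ ℕ // d ∈ Finset.univ.finsuppAntidiag k}

theorem mem_finsuppAntidiag_univ_iff {n k : ℕ} {d : Fin n →₀ ℕ} :
    d ∈ Finset.univ.finsuppAntidiag k ↔ d.degree = k := by
  simp [Finsupp.degree_eq_sum]

theorem card_expo (n k : ℕ) : Fintype.card (Expo n k) = (n + k - 1).choose k := by
  rw [Fintype.card_coe, Finset.card_finsuppAntidiag_nat_eq_choose, Finset.card_univ,
    Fintype.card_fin]

/-- The exponent of the monomial `X a * X b * X c`. -/
noncomputable def triExpo (a b c : Fin 6) : Expo 6 3 :=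
  ⟨Finsupp.single a 1 + Finsupp.single b 1 + Finsupp.single c 1, by
    rw [mem_finsuppAntidiag_univ_iff]
    simp⟩

theorem triExpo_swap_left (a b c : Fin 6) : triExpo b a c = triExpo a b c :=
  Subtype.ext (by simp only [triExpo]; abel)

theorem triExpo_swap_right (a b c : Fin 6) : triExpo a c b = triExpo a b c :=
  Subtype.ext (by simp only [triExpo]; abel)

theorem exists_triExpo_eq (d : Expo 6 3) : ∃ p : Fin 6 × Fin 6 × Fin 6,
    triExpo p.1 p.2.1 p.2.2 = d := by
  obtain ⟨d, hd⟩ := d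
  rw [mem_finsuppAntidiag_univ_iff] at hd
  have step : ∀ (n : ℕ) (d : Fin 6 →₀ ℕ), d.degree = n + 1 →
      ∃ (a : Fin 6) (d' : Fin 6 →₀ ℕ), d'.degree = n ∧ d = Finsupp.single a 1 + d' := by
    intro n d hd
    have hne : d ≠ 0 := by
      rintro rfl
      simp at hd
    obtain ⟨a, ha⟩ := Finsupp.ne_iff.1 hne
    have hle : Finsupp.single a 1 ≤ d := by
      rw [Finsupp.single_le_iff]
      exact Nat.one_le_iff_ne_zero.2 ha
    obtain ⟨d', rfl⟩ := exists_add_of_le hle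
    refine ⟨a, d', ?_, rfl⟩
    rw [map_add, Finsupp.degree_single] at hd
    omega
  obtain ⟨a, d₁, h₁, rfl⟩ := step 2 d hd
  obtain ⟨b, d₂, h₂, rfl⟩ := step 1 d₁ h₁
  obtain ⟨c, d₃, h₃, rfl⟩ := step 0 d₂ h₂
  rw [Finsupp.degree_eq_zero_iff] at h₃
  subst h₃
  exact ⟨(a, b, c), Subtype.ext (by simp only [triExpo]; abel)⟩

theorem monomial_triExpo (a b c : Fin 6) :
    monomial (triExpo a b c : Fin 6 →₀ ℕ) (1 : ℂ) = X a * X b * X c := by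
  simp [triExpo, X, monomial_mul]

/-- Two linear maps that agree on all `X a * X b * X c` agree on all cubic forms. -/
theorem LinearMap.eq_of_eq_on_cubic_monomials {M : Type*} [AddCommGroup M] [Module ℂ M]
    {ℓ ℓ' : MvPolynomial (Fin 6) ℂ →ₗ[ℂ] M}
    (h : ∀ a b c, ℓ (X a * X b * X c) = ℓ' (X a * X b * X c))
    {k : MvPolynomial (Fin 6) ℂ} (hk : k.IsHomogeneous 3) : ℓ k = ℓ' k := by
  rw [k.as_sum, map_sum, map_sum]
  refine Finset.sum_congr rfl fun d hd => ?_
  have hdeg : d.degree = 3 := by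
    by_contra hne
    exact (mem_support_iff.1 hd) (hk.coeff_eq_zero hne)
  obtain ⟨⟨a, b, c⟩, habc⟩ := exists_triExpo_eq ⟨d, mem_finsuppAntidiag_univ_iff.2 hdeg⟩
  have hd' : monomial d (coeff d k) = coeff d k • (X a * X b * X c) := by
    rw [← monomial_triExpo, habc, smul_monomial, smul_eq_mul, mul_one]
  rw [hd', map_smul, map_smul, h]

theorem coeff_pderiv_pow {n : ℕ} (i : Fin n) (m : ℕ) (e : Fin n →₀ ℕ) :
    ∃ r : ℂ, r ≠ 0 ∧ ∀ f : MvPolynomial (Fin n) ℂ,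
      coeff e ((((pderiv (R := ℂ) i).toLinearMap :
        Module.End ℂ (MvPolynomial (Fin n) ℂ)) ^ m) f) =
        r * coeff (e + Finsupp.single i m) f := by
  induction m generalizing e with
  | zero => exact ⟨1, one_ne_zero, by simp⟩
  | succ m ih =>
    obtain ⟨r, hr, h⟩ := ih e
    refine ⟨r * ((e i + m : ℕ) + 1), mul_ne_zero hr (Nat.cast_add_one_ne_zero _), fun f => ?_⟩
    rw [pow_succ, Module.End.mul_apply, h]
    simp only [Derivation.coeFn_coe, coeff_pderiv]
    rw [add_assoc, ← Finsupp.single_add]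
    simp
    ring

theorem coeff_monOp {n : ℕ} (d e : Fin n →₀ ℕ) :
    ∃ r : ℂ, r ≠ 0 ∧ ∀ f : MvPolynomial (Fin n) ℂ,
      coeff e (monOp d f) = r * coeff (e + d) f := by
  have key : ∀ (l : List (Fin n)) (e : Fin n →₀ ℕ), ∃ r : ℂ, r ≠ 0 ∧
      ∀ f : MvPolynomial (Fin n) ℂ,
        coeff e ((l.map fun i => ((pderiv (R := ℂ) i).toLinearMap :
          Module.End ℂ (MvPolynomial (Fin n) ℂ)) ^ (d i)).prod f) =
          r * coeff (e + (l.map fun i => Finsupp.single i (d i)).sum) f := by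
    intro l
    induction l with
    | nil => exact fun e => ⟨1, one_ne_zero, by simp⟩
    | cons i l ih =>
      intro e
      obtain ⟨r, hr, h⟩ := coeff_pderiv_pow i (d i) e
      obtain ⟨r', hr', h'⟩ := ih (e + Finsupp.single i (d i))
      refine ⟨r * r', mul_ne_zero hr hr', fun f => ?_⟩
      rw [List.map_cons, List.prod_cons, Module.End.mul_apply, h, h', List.map_cons,
        List.sum_cons, add_assoc, mul_assoc]
  obtain ⟨r, hr, h⟩ := key (List.finRange n) e
  refine ⟨r, hr, fun f => ?_⟩
  have hd : ((List.finRange n).map fun i => Finsupp.single i (d i)).sum = d := by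
    rw [← List.ofFn_eq_map, List.sum_ofFn, Finsupp.univ_sum_single]
  rw [← hd, ← h f, monOp, List.ofFn_eq_map, hd]

/-- The apolarity pairing with `f`, as a linear functional. -/
noncomputable def pairingLin {n : ℕ} (f : MvPolynomial (Fin n) ℂ) :
    MvPolynomial (Fin n) ℂ →ₗ[ℂ] ℂ :=
  (basisMonomials (Fin n) ℂ).constr ℂ fun d => coeff 0 (monOp d f)

theorem pairingLin_monomial {n : ℕ} (f : MvPolynomial (Fin n) ℂ) (d : Fin n →₀ ℕ) :
    pairingLin f (monomial d 1) = coeff 0 (monOp d f) := by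
  have h : monomial d (1 : ℂ) = basisMonomials (Fin n) ℂ d := by simp
  rw [pairingLin, h, Module.Basis.constr_basis]

theorem pairing_eq_pairingLin {n : ℕ} (f k : MvPolynomial (Fin n) ℂ) :
    pairing f k = pairingLin f k := by
  conv_rhs => rw [k.as_sum, map_sum]
  rw [pairing, apolar, map_sum]
  refine Finset.sum_congr rfl fun d _ => ?_
  have h : monomial d (coeff d k) = coeff d k • monomial d (1 : ℂ) := by
    rw [smul_monomial, smul_eq_mul, mul_one]
  rw [h, LinearMap.map_smul, pairingLin_monomial, smul_eval, smul_eq_mul]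
  congr 1
  rw [eval_zero']
  rfl

/-- The pairings of a cubic form with all monomials of degree three. -/
noncomputable def cubicCoords : homogeneousSubmodule (Fin 6) ℂ 3 →ₗ[ℂ] (Expo 6 3 → ℂ) :=
  LinearMap.pi fun d => (lcoeff ℂ 0).comp ((monOp (d : Fin 6 →₀ ℕ)).comp (Submodule.subtype _))

theorem cubicCoords_apply (f : homogeneousSubmodule (Fin 6) ℂ 3) (d : Expo 6 3) :
    cubicCoords f d = pairingLin (f : MvPolynomial (Fin 6) ℂ) (monomial (d : Fin 6 →₀ ℕ) 1) := by
  rw [pairingLin_monomial]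
  rfl

theorem cubicCoords_injective : Function.Injective cubicCoords := by
  rw [injective_iff_map_eq_zero]
  rintro ⟨f, hf⟩ h
  rw [mem_homogeneousSubmodule] at hf
  refine Subtype.ext (MvPolynomial.ext _ _ fun d => ?_)
  by_cases hd : d.degree = 3
  · have h0 := congrFun h ⟨d, mem_finsuppAntidiag_univ_iff.2 hd⟩
    rw [cubicCoords_apply, pairingLin_monomial] at h0
    obtain ⟨r, hr, h1⟩ := coeff_monOp d 0
    simpa [h1, hr] using h0
  · simpa using hf.coeff_eq_zero hd

/-- Parameters for cubic forms apolar to a Veronese surface: the entries of a matrix and the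
values of a linear functional on ternary sextic monomials. -/
abbrev Param : Type := (Fin 6 × Fin 6) ⊕ Expo 3 6

/-- The ternary quadratic form with coordinates `u` with respect to `nuPoly`. -/
noncomputable def quadForm (u : Fin 6 → ℂ) : MvPolynomial (Fin 3) ℂ :=
  ∑ j, u j • nuPoly j

/-- The quadratic forms given by the rows of the matrix part of a parameter. -/
noncomputable def paramQuad (x : Param → ℂ) (a : Fin 6) : MvPolynomial (Fin 3) ℂ :=
  quadForm fun j => x (.inl (a, j))

/-- The linear functional given by the second part of a parameter. -/
noncomputable def paramFun (x : Param → ℂ) : MvPolynomial (Fin 3) ℂ →ₗ[ℂ] ℂ :=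
  ∑ s : Expo 3 6, x (.inr s) • lcoeff ℂ (s : Fin 3 →₀ ℕ)

theorem nuPoly_isHomogeneous (j : Fin 6) : (nuPoly j).IsHomogeneous 2 := by
  have h : ∀ a b : Fin 3, (X a * X b : MvPolynomial (Fin 3) ℂ).IsHomogeneous 2 :=
    fun a b => (isHomogeneous_X ℂ a).mul (isHomogeneous_X ℂ b)
  have h2 : ∀ a b : Fin 3, (2 * X a * X b : MvPolynomial (Fin 3) ℂ).IsHomogeneous 2 := by
    intro a b
    rw [mul_assoc]
    exact (h a b).C_mul 2
  fin_cases j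
  · simpa [nuPoly, sq] using h 0 0
  · exact h2 0 1
  · exact h2 0 2
  · simpa [nuPoly, sq] using h 1 1
  · exact h2 1 2
  · simpa [nuPoly, sq] using h 2 2

theorem eval_nuPoly (w : Fin 3 → ℂ) (j : Fin 6) : eval w (nuPoly j) = nu w j := by
  fin_cases j <;> simp [nuPoly, nu]

theorem quadForm_isHomogeneous (u : Fin 6 → ℂ) : (quadForm u).IsHomogeneous 2 :=
  IsHomogeneous.sum _ _ _ fun j _ => by
    rw [smul_eq_C_mul]
    exact (nuPoly_isHomogeneous j).C_mul _

theorem quadForm_mul_isHomogeneous (u v w : Fin 6 → ℂ) :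
    (quadForm u * quadForm v * quadForm w).IsHomogeneous 6 :=
  ((quadForm_isHomogeneous u).mul (quadForm_isHomogeneous v)).mul (quadForm_isHomogeneous w)

/-- Every linear functional is given on sextic forms by its values on monomials. -/
theorem paramFun_eq_of_isHomogeneous {x : Param → ℂ} {Λ : MvPolynomial (Fin 3) ℂ →ₗ[ℂ] ℂ}
    (hx : ∀ s : Expo 3 6, x (.inr s) = Λ (monomial (s : Fin 3 →₀ ℕ) 1))
    {g : MvPolynomial (Fin 3) ℂ} (hg : g.IsHomogeneous 6) : paramFun x g = Λ g := by
  have hsub : g.support ⊆ Finset.univ.finsuppAntidiag 6 := by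
    intro d hd
    rw [mem_finsuppAntidiag_univ_iff]
    by_contra hne
    exact (mem_support_iff.1 hd) (hg.coeff_eq_zero hne)
  have hsum : g = ∑ s : Expo 3 6, coeff (s : Fin 3 →₀ ℕ) g • monomial (s : Fin 3 →₀ ℕ) (1 : ℂ) := by
    conv_lhs => rw [g.as_sum, Finset.sum_subset hsub fun d _ hd => by
      rw [notMem_support_iff.1 hd, monomial_zero]]
    rw [← Finset.sum_coe_sort]
    exact Finset.sum_congr rfl fun s _ => by rw [smul_monomial, smul_eq_mul, mul_one]
  conv_rhs => rw [hsum, map_sum]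
  simp [paramFun, hx, mul_comm]

/-- The coordinates of the parametrized cubic form, as polynomials in the parameters. -/
noncomputable def cubicParam (d : Expo 6 3) : MvPolynomial Param ℂ :=
  let p := (exists_triExpo_eq d).choose
  ∑ j, ∑ k, ∑ l, X (.inl (p.1, j)) * X (.inl (p.2.1, k)) * X (.inl (p.2.2, l)) *
    ∑ s : Expo 3 6, C (coeff (s : Fin 3 →₀ ℕ) (nuPoly j * nuPoly k * nuPoly l)) * X (.inr s)

/-- The substitution of the rows of a parameter into a polynomial in six variables. -/
noncomputable def paramSubst (x : Param → ℂ) :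
    MvPolynomial (Fin 6) ℂ →ₐ[ℂ] MvPolynomial (Fin 3) ℂ :=
  aeval (paramQuad x)

theorem eval_cubicParam (x : Param → ℂ) (d : Expo 6 3) :
    eval x (cubicParam d) = paramFun x (paramSubst x (monomial (d : Fin 6 →₀ ℕ) 1)) := by
  have hp := (exists_triExpo_eq d).choose_spec
  set p := (exists_triExpo_eq d).choose with hpdef
  have h1 : paramSubst x (monomial (d : Fin 6 →₀ ℕ) 1) =
      ∑ j, ∑ k, ∑ l, (x (.inl (p.1, j)) * x (.inl (p.2.1, k)) * x (.inl (p.2.2, l))) •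
        (nuPoly j * nuPoly k * nuPoly l) := by
    rw [← hp, monomial_triExpo]
    simp only [paramSubst, map_mul, aeval_X, paramQuad, quadForm]
    rw [Finset.sum_mul_sum, Finset.sum_mul]
    refine Finset.sum_congr rfl fun j _ => ?_
    rw [Finset.sum_mul]
    refine Finset.sum_congr rfl fun k _ => ?_
    rw [Finset.mul_sum]
    refine Finset.sum_congr rfl fun l _ => ?_
    rw [smul_mul_smul_comm, smul_mul_smul_comm]
  rw [h1, cubicParam, ← hpdef]
  simp only [map_sum, map_mul, map_smul, eval_X, eval_C, smul_eq_mul, paramFun,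
    LinearMap.sum_apply, LinearMap.smul_apply, lcoeff_apply]
  simp only [mul_comm (coeff _ _) (x _)]

theorem eval_cubicParam_triExpo (x : Param → ℂ) (a b c : Fin 6) :
    eval x (cubicParam (triExpo a b c)) =
      paramFun x (paramQuad x a * paramQuad x b * paramQuad x c) := by
  rw [eval_cubicParam, monomial_triExpo]
  simp [paramSubst]

/-- The determinant of the matrix part of a parameter, as a polynomial. -/
noncomputable def paramDet : MvPolynomial Param ℂ :=
  (Matrix.of fun i j : Fin 6 => (X (.inl (i, j)) : MvPolynomial Param ℂ)).det

theorem eval_paramDet (x : Param → ℂ) :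
    eval x paramDet = (Matrix.of fun i j : Fin 6 => x (.inl (i, j))).det := by
  rw [paramDet, RingHom.map_det]
  congr 1
  ext i j
  simp

theorem paramDet_ne_zero : paramDet ≠ 0 := by
  intro h
  have h1 := eval_paramDet (Sum.elim (fun p => if p.1 = p.2 then 1 else 0) 0)
  have h2 : (Matrix.of fun i j : Fin 6 => (Sum.elim (fun p : Fin 6 × Fin 6 =>
      if p.1 = p.2 then (1 : ℂ) else 0) (0 : Expo 3 6 → ℂ)) (.inl (i, j))) = 1 := by
    ext i j
    simp [Matrix.one_apply]
  rw [h, h2, Matrix.det_one, map_zero] at h1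
  exact zero_ne_one h1

theorem eval_paramSubst (x : Param → ℂ) (w : Fin 3 → ℂ) (k : MvPolynomial (Fin 6) ℂ) :
    eval w (paramSubst x k) =
      eval ((Matrix.of fun i j : Fin 6 => x (.inl (i, j))).mulVec (nu w)) k := by
  rw [paramSubst, eval_aeval_mvPolynomial]
  congr 2
  funext a
  simp [paramQuad, quadForm, Matrix.mulVec, dotProduct, eval_nuPoly, smul_eval]

/-- The parametrization of the cubic forms apolar to some Veronese surface. -/
theorem exists_apolar_veronese_iff (f : homogeneousSubmodule (Fin 6) ℂ 3) :
    (∃ A : (Matrix (Fin 6) (Fin 6) ℂ)ˣ, ∀ k : MvPolynomial (Fin 6) ℂ, k.IsHomogeneous 3 →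
      (∀ w' : Fin 3 → ℂ, eval ((A : Matrix (Fin 6) (Fin 6) ℂ).mulVec (nu w')) k = 0) →
        pairing (f : MvPolynomial (Fin 6) ℂ) k = 0) ↔
    ∃ x : Param → ℂ, eval x paramDet ≠ 0 ∧ cubicCoords f = fun d => eval x (cubicParam d) := by
  constructor
  · rintro ⟨A, hA⟩
    let x₀ : Param → ℂ := Sum.elim (fun p => (A : Matrix (Fin 6) (Fin 6) ℂ) p.1 p.2) 0
    let g := (paramSubst x₀).toLinearMap.comp (homogeneousSubmodule (Fin 6) ℂ 3).subtype
    let ℓ := (pairingLin (f : MvPolynomial (Fin 6) ℂ)).comp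
      (homogeneousSubmodule (Fin 6) ℂ 3).subtype
    have hker : ℓ ∈ (LinearMap.ker g).dualAnnihilator := by
      rw [Submodule.mem_dualAnnihilator]
      rintro ⟨k, hk⟩ hgk
      rw [LinearMap.mem_ker] at hgk
      have h0 := hA k hk fun w => by
        have h1 := eval_paramSubst x₀ w k
        have h2 : paramSubst x₀ k = 0 := hgk
        rw [h2, map_zero] at h1
        exact h1.symm
      rwa [pairing_eq_pairingLin] at h0
    rw [← LinearMap.range_dualMap_eq_dualAnnihilator_ker] at hker
    obtain ⟨Λ, hΛ⟩ := hker
    let x : Param → ℂ := Sum.elim (fun p => (A : Matrix (Fin 6) (Fin 6) ℂ) p.1 p.2)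
      fun s => Λ (monomial (s : Fin 3 →₀ ℕ) 1)
    have hdet : (Matrix.of fun i j : Fin 6 => x (.inl (i, j))) = (A : Matrix _ _ ℂ) := by
      ext i j
      rfl
    refine ⟨x, ?_, ?_⟩
    · rw [eval_paramDet, hdet]
      exact ((Matrix.isUnit_iff_isUnit_det _).1 A.isUnit).ne_zero
    · funext d
      obtain ⟨⟨a, b, c⟩, rfl⟩ := exists_triExpo_eq d
      have hmem : monomial (triExpo a b c : Fin 6 →₀ ℕ) (1 : ℂ) ∈
          homogeneousSubmodule (Fin 6) ℂ 3 :=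
        isHomogeneous_monomial _ (mem_finsuppAntidiag_univ_iff.1 (triExpo a b c).2)
      have h1 := LinearMap.congr_fun hΛ ⟨_, hmem⟩
      have h2 := paramFun_eq_of_isHomogeneous (x := x) (Λ := Λ) (fun s => rfl)
        (g := paramQuad x a * paramQuad x b * paramQuad x c) (quadForm_mul_isHomogeneous _ _ _)
      rw [cubicCoords_apply, eval_cubicParam_triExpo]
      refine Eq.trans (h1.symm.trans ?_) h2.symm
      simp only [LinearMap.dualMap_apply, g, LinearMap.comp_apply, Submodule.subtype_apply,
        monomial_triExpo, AlgHom.toLinearMap_apply, map_mul, paramSubst, aeval_X]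
      rfl
  · rintro ⟨x, hx, hf⟩
    rw [eval_paramDet] at hx
    have hu : IsUnit (Matrix.of fun i j : Fin 6 => x (.inl (i, j))) :=
      (Matrix.isUnit_iff_isUnit_det _).2 (isUnit_iff_ne_zero.2 hx)
    refine ⟨hu.unit, fun k hk hk0 => ?_⟩
    have h1 : paramSubst x k = 0 := MvPolynomial.funext fun w => by
      rw [eval_paramSubst, map_zero]
      exact hk0 w
    rw [pairing_eq_pairingLin, LinearMap.eq_of_eq_on_cubic_monomials
      (ℓ' := (paramFun x).comp (paramSubst x).toLinearMap) (fun a b c => ?_) hk]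
    · simp [h1]
    · rw [← monomial_triExpo, ← cubicCoords_apply, hf]
      exact eval_cubicParam x _

/-- The exponents of the first two variables in the components of the Veronese map, encoded
in base seven. -/
def veroneseCode : Fin 6 → ℕ := ![14, 8, 7, 2, 1, 0]

set_option maxHeartbeats 2000000 in
/-- The linear equations satisfied by a normal vector to the parametrized family at the base
point have only the trivial solution once one coordinate is required to vanish. -/
theorem eq_zero_of_hankel_of_apolar {k : Fin 6 → Fin 6 → Fin 6 → ℂ}
    (h1 : ∀ a b c, k b a c = k a b c) (h2 : ∀ a b c, k a c b = k a b c)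
    (hH : ∀ p q, p + q ≤ 6 → ∑ a, ∑ b, ∑ c,
      (if veroneseCode a + veroneseCode b + veroneseCode c = 7 * p + q then k a b c else 0) = 0)
    (hA : ∀ i j, ∑ b, ∑ c,
      (if veroneseCode j + veroneseCode b + veroneseCode c ∈ ({3, 21, 24} : Finset ℕ)
        then k i b c else 0) = 0)
    (h035 : k 0 3 5 = 0) (a b c : Fin 6) : k a b c = 0 := by
  have a0 := fun i => hA i 0
  have a1 := fun i => hA i 1
  have a2 := fun i => hA i 2
  have a3 := fun i => hA i 3
  have a4 := fun i => hA i 4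
  have a5 := fun i => hA i 5
  simp [veroneseCode, Fin.sum_univ_six, h2] at a0 a1 a2 a3 a4 a5
  have e0 := hH 0 0 (by norm_num)
  have e1 := hH 0 1 (by norm_num)
  have e2 := hH 0 2 (by norm_num)
  have e3 := hH 0 3 (by norm_num)
  have e4 := hH 0 4 (by norm_num)
  have e5 := hH 0 5 (by norm_num)
  have e6 := hH 0 6 (by norm_num)
  have e7 := hH 1 0 (by norm_num)
  have e8 := hH 1 1 (by norm_num)
  have e9 := hH 1 2 (by norm_num)
  have e10 := hH 1 3 (by norm_num)
  have e11 := hH 1 4 (by norm_num)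
  have e12 := hH 1 5 (by norm_num)
  have e14 := hH 2 0 (by norm_num)
  have e15 := hH 2 1 (by norm_num)
  have e16 := hH 2 2 (by norm_num)
  have e17 := hH 2 3 (by norm_num)
  have e18 := hH 2 4 (by norm_num)
  have e21 := hH 3 0 (by norm_num)
  have e22 := hH 3 1 (by norm_num)
  have e23 := hH 3 2 (by norm_num)
  have e24 := hH 3 3 (by norm_num)
  have e28 := hH 4 0 (by norm_num)
  have e29 := hH 4 1 (by norm_num)
  have e30 := hH 4 2 (by norm_num)
  have e35 := hH 5 0 (by norm_num)
  have e36 := hH 5 1 (by norm_num)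
  have e42 := hH 6 0 (by norm_num)
  simp [veroneseCode, Fin.sum_univ_six, h1, h2] at e0 e1 e2 e3 e4 e5 e6 e7 e8 e9
  simp [veroneseCode, Fin.sum_univ_six, h1, h2] at e10 e11 e12 e14 e15 e16 e17 e18 e21 e22
  simp [veroneseCode, Fin.sum_univ_six, h1, h2] at e23 e24 e28 e29 e30 e35 e36 e42
  have k001 :
      k 0 0 1 = 0 ∧ k 0 3 3 = 0 ∧ k 0 4 5 = 0 ∧ k 1 1 3 = 0 ∧ k 1 2 5 = 0 ∧ k 2 2 4 = 0 := by
    have f0 := a0 1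
    have f1 := a1 3
    have f2 := a2 4
    have f3 := a3 0
    simp only [h1, h2] at f0 f1 f2 f3
    clear a0 a1 a2 a3 a4 a5 h1 h2
    refine ⟨?_, ?_, ?_, ?_, ?_, ?_⟩ <;> grind
  have k002 :
      k 0 0 2 = 0 ∧ k 0 3 4 = 0 ∧ k 0 5 5 = 0 ∧ k 1 1 4 = 0 ∧ k 1 2 3 = 0 ∧ k 2 2 5 = 0 := by
    have f0 := a0 2
    have f1 := a1 4
    have f2 := a2 5
    have f3 := a5 0
    simp only [h1, h2] at f0 f1 f2 f3
    clear a0 a1 a2 a3 a4 a5 h1 h2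
    refine ⟨?_, ?_, ?_, ?_, ?_, ?_⟩ <;> grind
  have k003 :
      k 0 0 3 = 0 ∧ k 0 1 1 = 0 ∧ k 1 3 3 = 0 ∧ k 1 4 5 = 0 ∧ k 2 3 5 = 0 ∧ k 2 4 4 = 0 := by
    have f0 := a0 3
    have f1 := a1 0
    have f2 := a3 1
    have f3 := a4 2
    simp only [h1] at f0 f1 f2 f3
    clear a0 a1 a2 a3 a4 a5 h1 h2
    refine ⟨?_, ?_, ?_, ?_, ?_, ?_⟩ <;> grind
  have k004 :
      k 0 0 4 = 0 ∧ k 0 1 2 = 0 ∧ k 1 3 4 = 0 ∧ k 1 5 5 = 0 ∧ k 2 3 3 = 0 ∧ k 2 4 5 = 0 := by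
    have f0 := a0 4
    have f1 := a3 2
    have f2 := a5 1
    simp only [h1, h2] at f0 f1 f2
    clear a0 a1 a2 a3 a4 a5 h1 h2
    refine ⟨?_, ?_, ?_, ?_, ?_, ?_⟩ <;> grind
  have k005 :
      k 0 0 5 = 0 ∧ k 0 2 2 = 0 ∧ k 1 3 5 = 0 ∧ k 1 4 4 = 0 ∧ k 2 3 4 = 0 ∧ k 2 5 5 = 0 := by
    have f0 := a0 5
    have f1 := a2 0
    have f2 := a4 1
    have f3 := a5 2
    simp only [h1, h2] at f0 f1 f2 f3
    clear a0 a1 a2 a3 a4 a5 h1 h2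
    refine ⟨?_, ?_, ?_, ?_, ?_, ?_⟩ <;> grind
  have k013 :
      k 0 1 3 = 0 ∧ k 0 2 5 = 0 ∧ k 1 1 1 = 0 ∧ k 2 2 2 = 0 ∧ k 3 4 5 = 0 ∧ k 4 4 4 = 0 := by
    have f0 := a0 0
    have f1 := a1 1
    have f2 := a2 2
    have f3 := a3 3
    have f4 := a4 4
    have f5 := a5 5
    simp only [h1, h2] at f0 f1 f2 f3 f4 f5
    clear a0 a1 a2 a3 a4 a5 h1 h2
    refine ⟨?_, ?_, ?_, ?_, ?_, ?_⟩ <;> grind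
  have k014 :
      k 0 1 4 = 0 ∧ k 0 2 3 = 0 ∧ k 1 1 2 = 0 ∧ k 3 3 4 = 0 ∧ k 3 5 5 = 0 ∧ k 4 4 5 = 0 := by
    have f0 := a1 2
    have f1 := a3 4
    have f2 := a4 5
    have f3 := a5 3
    simp only [h1, h2] at f0 f1 f2 f3
    clear a0 a1 a2 a3 a4 a5 h1 h2
    refine ⟨?_, ?_, ?_, ?_, ?_, ?_⟩ <;> grind
  have k015 :
      k 0 1 5 = 0 ∧ k 0 2 4 = 0 ∧ k 1 2 2 = 0 ∧ k 3 3 5 = 0 ∧ k 3 4 4 = 0 ∧ k 4 5 5 = 0 := by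
    have f0 := a2 1
    have f1 := a3 5
    have f2 := a4 3
    have f3 := a5 4
    simp only [h1, h2] at f0 f1 f2 f3
    clear a0 a1 a2 a3 a4 a5 h1 h2
    refine ⟨?_, ?_, ?_, ?_, ?_, ?_⟩ <;> grind
  have k044 : k 0 4 4 = 0 ∧ k 1 1 5 = 0 ∧ k 1 2 4 = 0 ∧ k 2 2 3 = 0 := by
    have f0 := a1 5
    have f1 := a2 3
    have f2 := a4 0
    simp only [h1, h2] at f0 f1 f2
    clear a0 a1 a2 a3 a4 a5 h1 h2
    refine ⟨?_, ?_, ?_, ?_⟩ <;> grind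
  have six : ∀ {p : Fin 6 → Prop}, p 0 → p 1 → p 2 → p 3 → p 4 → p 5 → ∀ a, p a := by
    intro p _ _ _ _ _ _ a
    fin_cases a <;> assumption
  revert a b c
  refine six ?_ ?_ ?_ ?_ ?_ ?_ <;> refine six ?_ ?_ ?_ ?_ ?_ ?_ <;>
    refine six ?_ ?_ ?_ ?_ ?_ ?_ <;>
    simp [h1, h2, h035, e42, e6, e0, k001, k002, k003, k004, k005, k013, k014, k015, k044]

/-- The first index of the monomial in a component of the Veronese map. -/
def veroneseFst : Fin 6 → Fin 3 := ![0, 0, 0, 1, 1, 2]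

/-- The second index of the monomial in a component of the Veronese map. -/
def veroneseSnd : Fin 6 → Fin 3 := ![0, 1, 2, 1, 2, 2]

/-- The coefficients of the components of the Veronese map. -/
def veroneseCoeff : Fin 6 → ℂ := ![1, 2, 2, 1, 2, 1]

theorem veroneseCoeff_ne_zero (j : Fin 6) : veroneseCoeff j ≠ 0 := by
  fin_cases j <;> simp [veroneseCoeff]

theorem nuPoly_eq (j : Fin 6) :
    nuPoly j = veroneseCoeff j • (X (veroneseFst j) * X (veroneseSnd j)) := by
  have h2 : (C 2 : MvPolynomial (Fin 3) ℂ) = 2 := map_ofNat C 2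
  fin_cases j <;>
    simp [nuPoly, veroneseCoeff, veroneseFst, veroneseSnd, sq, smul_eq_C_mul, mul_assoc, h2]

/-- The exponent of the monomial in a component of the Veronese map. -/
noncomputable def veroneseExpo (j : Fin 6) : Fin 3 →₀ ℕ :=
  Finsupp.single (veroneseFst j) 1 + Finsupp.single (veroneseSnd j) 1

theorem nuPoly_eq_monomial (j : Fin 6) :
    nuPoly j = monomial (veroneseExpo j) (veroneseCoeff j) := by
  rw [nuPoly_eq, X, X, monomial_mul, smul_monomial]
  simp [veroneseExpo]

theorem veroneseCode_eq (j : Fin 6) :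
    veroneseCode j = 7 * veroneseExpo j 0 + veroneseExpo j 1 := by
  fin_cases j <;> simp [veroneseExpo, veroneseCode, veroneseFst, veroneseSnd]

/-- The exponent of the product of three components of the Veronese map. -/
noncomputable def veroneseTriExpo (a b c : Fin 6) : Expo 3 6 :=
  ⟨veroneseExpo a + veroneseExpo b + veroneseExpo c, by
    rw [mem_finsuppAntidiag_univ_iff]
    simp [veroneseExpo]⟩

theorem veroneseTriExpo_eq_iff (a b c : Fin 6) (s : Expo 3 6) :
    veroneseTriExpo a b c = s ↔ veroneseCode a + veroneseCode b + veroneseCode c =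
      7 * (s : Fin 3 →₀ ℕ) 0 + (s : Fin 3 →₀ ℕ) 1 := by
  have hs := mem_finsuppAntidiag_univ_iff.1 s.2
  have ht := mem_finsuppAntidiag_univ_iff.1 (veroneseTriExpo a b c).2
  have h0 : ∀ i, (veroneseTriExpo a b c : Fin 3 →₀ ℕ) i =
    veroneseExpo a i + veroneseExpo b i + veroneseExpo c i := fun i => rfl
  rw [Finsupp.degree_eq_sum, Fin.sum_univ_three] at hs ht
  rw [Subtype.ext_iff, Finsupp.ext_iff, veroneseCode_eq, veroneseCode_eq, veroneseCode_eq]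
  simp only [Fin.forall_fin_succ, Fin.succ_zero_eq_one, Fin.succ_one_eq_two]
  have h1 := h0 0
  have h2 := h0 1
  constructor
  · rintro ⟨h, h', -⟩
    omega
  · intro h
    refine ⟨by omega, by omega, ?_, fun i => i.elim0⟩
    change (veroneseTriExpo a b c : Fin 3 →₀ ℕ) 2 = (s : Fin 3 →₀ ℕ) 2
    omega

theorem paramFun_nuPoly_mul (x : Param → ℂ) (a b c : Fin 6) :
    paramFun x (nuPoly a * nuPoly b * nuPoly c) =
      veroneseCoeff a * veroneseCoeff b * veroneseCoeff c *
        x (.inr (veroneseTriExpo a b c)) := by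
  simp only [nuPoly_eq_monomial, monomial_mul, paramFun, LinearMap.sum_apply,
    LinearMap.smul_apply, lcoeff_apply, coeff_monomial, smul_eq_mul]
  rw [Finset.sum_eq_single (veroneseTriExpo a b c)]
  · simp [veroneseTriExpo, mul_comm]
  · intro s _ hs
    rw [if_neg, mul_zero]
    intro h
    exact hs (Subtype.ext h.symm)
  · simp

theorem paramQuad_add_smul (x v : Param → ℂ) (t : ℂ) (a : Fin 6) :
    paramQuad (x + t • v) a = paramQuad x a + t • paramQuad v a := by
  simp [paramQuad, quadForm, add_smul, Finset.sum_add_distrib, Finset.smul_sum, mul_smul]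

theorem paramFun_add_smul (x v : Param → ℂ) (t : ℂ) :
    paramFun (x + t • v) = paramFun x + t • paramFun v := by
  simp [paramFun, add_smul, Finset.sum_add_distrib, Finset.smul_sum, mul_smul]

theorem hasDerivAt_eval_cubicParam (x v : Param → ℂ) (a b c : Fin 6) :
    HasDerivAt (fun t : ℂ => eval (x + t • v) (cubicParam (triExpo a b c)))
      (paramFun v (paramQuad x a * paramQuad x b * paramQuad x c) +
        paramFun x (paramQuad v a * paramQuad x b * paramQuad x c +
          paramQuad x a * paramQuad v b * paramQuad x c +
          paramQuad x a * paramQuad x b * paramQuad v c)) 0 := by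
  simp only [eval_cubicParam_triExpo, paramQuad_add_smul, paramFun_add_smul]
  generalize paramQuad x a = x₁
  generalize paramQuad x b = x₂
  generalize paramQuad x c = x₃
  generalize paramQuad v a = v₁
  generalize paramQuad v b = v₂
  generalize paramQuad v c = v₃
  generalize paramFun x = Λ
  generalize paramFun v = M
  have hexp : ∀ t : ℂ, (x₁ + t • v₁) * (x₂ + t • v₂) * (x₃ + t • v₃) = x₁ * x₂ * x₃ +
      t • (v₁ * x₂ * x₃ + x₁ * v₂ * x₃ + x₁ * x₂ * v₃) +
      t ^ 2 • (v₁ * v₂ * x₃ + v₁ * x₂ * v₃ + x₁ * v₂ * v₃) + t ^ 3 • (v₁ * v₂ * v₃) := by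
    intro t
    simp only [smul_eq_C_mul, map_pow]
    ring
  simp only [hexp]
  generalize x₁ * x₂ * x₃ = y₀
  generalize v₁ * x₂ * x₃ + x₁ * v₂ * x₃ + x₁ * x₂ * v₃ = y₁
  generalize v₁ * v₂ * x₃ + v₁ * x₂ * v₃ + x₁ * v₂ * v₃ = y₂
  generalize v₁ * v₂ * v₃ = y₃
  have hpoly : ∀ A B D E F : ℂ, HasDerivAt
      (fun t : ℂ => A + t * B + t ^ 2 * D + t ^ 3 * E + t ^ 4 * F) B 0 := by
    intro A B D E F
    have hid : ∀ n : ℕ, HasDerivAt (fun t : ℂ => t ^ n) (n * 0 ^ (n - 1)) 0 :=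
      fun n => hasDerivAt_pow n 0
    have h := (((((hasDerivAt_id' (0 : ℂ)).mul_const B).const_add A).fun_add
      ((hid 2).mul_const D)).fun_add ((hid 3).mul_const E)).fun_add ((hid 4).mul_const F)
    exact h.congr_deriv (by norm_num)
  have hfun : (fun t : ℂ => (Λ + t • M) (y₀ + t • y₁ + t ^ 2 • y₂ + t ^ 3 • y₃)) =
      fun t : ℂ => Λ y₀ + t * (M y₀ + Λ y₁) + t ^ 2 * (M y₁ + Λ y₂) + t ^ 3 * (M y₂ + Λ y₃) +
        t ^ 4 * M y₃ := by
    funext t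
    simp only [map_add, map_smul, LinearMap.add_apply, LinearMap.smul_apply, smul_eq_mul]
    ring
  rw [hfun]
  exact hpoly _ _ _ _ _

/-- The parameter at which the parametrization is shown to have the maximal rank. -/
noncomputable def baseParam : Param → ℂ :=
  Sum.elim (fun p => if p.1 = p.2 then 1 else 0) fun s =>
    if 7 * (s : Fin 3 →₀ ℕ) 0 + (s : Fin 3 →₀ ℕ) 1 ∈ ({3, 21, 24} : Finset ℕ) then 1 else 0

theorem paramQuad_baseParam (a : Fin 6) : paramQuad baseParam a = nuPoly a := by
  simp [paramQuad, quadForm, baseParam]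

theorem paramFun_baseParam (a b c : Fin 6) :
    paramFun baseParam (nuPoly a * nuPoly b * nuPoly c) =
      if veroneseCode a + veroneseCode b + veroneseCode c ∈ ({3, 21, 24} : Finset ℕ)
      then veroneseCoeff a * veroneseCoeff b * veroneseCoeff c else 0 := by
  rw [paramFun_nuPoly_mul, (veroneseTriExpo_eq_iff a b c _).1 rfl]
  simp [baseParam]

/-- Sums over cubic exponents as sums over triples of indices. -/
theorem sum_expo_eq_sum_triExpo (c : Expo 6 3 → ℂ) : ∃ k : Expo 6 3 → ℂ,
    (∀ d, k d = 0 ↔ c d = 0) ∧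
    ∀ φ : Expo 6 3 → ℂ, ∑ d, c d * φ d = ∑ a, ∑ b, ∑ e, k (triExpo a b e) * φ (triExpo a b e) := by
  classical
  let τ : Fin 6 × Fin 6 × Fin 6 → Expo 6 3 := fun p => triExpo p.1 p.2.1 p.2.2
  let N : Expo 6 3 → ℕ := fun d => (Finset.univ.filter fun p => τ p = d).card
  have hN : ∀ d, (N d : ℂ) ≠ 0 := by
    intro d
    obtain ⟨p, hp⟩ := exists_triExpo_eq d
    rw [Nat.cast_ne_zero]
    exact Finset.card_ne_zero.2 ⟨p, by simpa [τ] using hp⟩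
  refine ⟨fun d => c d / N d, fun d => by simp [hN d], fun φ => ?_⟩
  have h1 : ∑ p, c (τ p) / N (τ p) * φ (τ p) = ∑ d, c d * φ d := by
    rw [← Finset.sum_fiberwise Finset.univ τ]
    refine Finset.sum_congr rfl fun d _ => ?_
    rw [Finset.sum_congr rfl (g := fun _ => c d / N d * φ d) fun p hp => by
      rw [(Finset.mem_filter.1 hp).2], Finset.sum_const, nsmul_eq_mul]
    change (N d : ℂ) * _ = _
    field_simp [hN d]
  rw [← h1, Fintype.sum_prod_type]
  simp only [Fintype.sum_prod_type, τ]

/-- The combinations of coordinates whose differential vanishes at the base parameter. -/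
theorem eq_zero_of_deriv_cubicParam_eq_zero {c : Expo 6 3 → ℂ} (h035 : c (triExpo 0 3 5) = 0)
    (hc : ∀ v : Param → ℂ,
      deriv (fun t : ℂ => ∑ d, c d * eval (baseParam + t • v) (cubicParam d)) 0 = 0) : c = 0 := by
  obtain ⟨k, hk0, hk⟩ := sum_expo_eq_sum_triExpo c
  have hD : ∀ v : Param → ℂ, ∑ a, ∑ b, ∑ e, k (triExpo a b e) *
      (paramFun v (nuPoly a * nuPoly b * nuPoly e) +
        paramFun baseParam (paramQuad v a * nuPoly b * nuPoly e +
          nuPoly a * paramQuad v b * nuPoly e + nuPoly a * nuPoly b * paramQuad v e)) = 0 := by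
    intro v
    rw [← hc v]
    refine (HasDerivAt.deriv ?_).symm
    simp only [hk fun d => eval (baseParam + _ • v) (cubicParam d)]
    refine HasDerivAt.fun_sum fun a _ => HasDerivAt.fun_sum fun b _ =>
      HasDerivAt.fun_sum fun e _ => ?_
    have h := (hasDerivAt_eval_cubicParam baseParam v a b e).const_mul (k (triExpo a b e))
    simpa only [paramQuad_baseParam] using h
  have hA : ∀ i j, ∑ b, ∑ e, k (triExpo i b e) *
      paramFun baseParam (nuPoly j * nuPoly b * nuPoly e) = 0 := by
    intro i j
    have h := hD (Sum.elim (Pi.single (i, j) 1) 0)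
    have hq : ∀ a, paramQuad (Sum.elim (Pi.single (i, j) 1) 0) a =
        (if a = i then (1 : ℂ) else 0) • nuPoly j := by
      intro a
      by_cases ha : a = i
      · subst ha
        simp [paramQuad, quadForm, Pi.single_apply]
      · simp [paramQuad, quadForm, ha]
    have hf : paramFun (Sum.elim (Pi.single (i, j) 1) 0) = 0 := by
      simp [paramFun]
    simp only [hq, hf, LinearMap.zero_apply, zero_add, smul_mul_assoc, mul_smul_comm, map_add,
      map_smul, smul_eq_mul, mul_add, Finset.sum_add_distrib, ite_mul, mul_ite, one_mul, zero_mul,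
      mul_zero] at h
    have h1 : ∀ φ : Fin 6 → Fin 6 → Fin 6 → ℂ, (∑ a, ∑ b, ∑ e, if a = i then φ a b e else 0) =
        ∑ b, ∑ e, φ i b e := by
      intro φ
      rw [Finset.sum_eq_single i (fun a _ ha => by simp [ha]) (by simp)]
      simp
    have h2 : ∀ φ : Fin 6 → Fin 6 → Fin 6 → ℂ, (∑ a, ∑ b, ∑ e, if b = i then φ a b e else 0) =
        ∑ b, ∑ e, φ b i e := by
      intro φ
      refine Finset.sum_congr rfl fun a _ => ?_
      rw [Finset.sum_eq_single i (fun a _ ha => by simp [ha]) (by simp)]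
      simp
    have h3 : ∀ φ : Fin 6 → Fin 6 → Fin 6 → ℂ, (∑ a, ∑ b, ∑ e, if e = i then φ a b e else 0) =
        ∑ b, ∑ e, φ b e i := by
      intro φ
      refine Finset.sum_congr rfl fun a _ => Finset.sum_congr rfl fun b _ => ?_
      rw [Finset.sum_eq_single i (fun a _ ha => by simp [ha]) (by simp)]
      simp
    rw [h1, h2, h3] at h
    have e2 : ∀ b e, k (triExpo b i e) * paramFun baseParam (nuPoly b * nuPoly j * nuPoly e) =
        k (triExpo i b e) * paramFun baseParam (nuPoly j * nuPoly b * nuPoly e) := fun b e => by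
      rw [triExpo_swap_left, mul_comm (nuPoly b)]
    have e3 : ∀ b e, k (triExpo b e i) * paramFun baseParam (nuPoly b * nuPoly e * nuPoly j) =
        k (triExpo i b e) * paramFun baseParam (nuPoly j * nuPoly b * nuPoly e) := fun b e => by
      rw [triExpo_swap_right, triExpo_swap_left, mul_comm (nuPoly b * nuPoly e), mul_assoc]
    simp only [e2, e3] at h
    have h4 : (3 : ℂ) * ∑ b, ∑ e, k (triExpo i b e) *
      paramFun baseParam (nuPoly j * nuPoly b * nuPoly e) = 0 := by linear_combination h
    simpa using h4
  let K : Fin 6 → Fin 6 → Fin 6 → ℂ := fun a b e =>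
    veroneseCoeff a * veroneseCoeff b * veroneseCoeff e * k (triExpo a b e)
  have hK : ∀ a b e, K a b e = 0 := by
    refine eq_zero_of_hankel_of_apolar ?_ ?_ ?_ ?_ ?_
    · intro a b e
      simp only [K]
      rw [triExpo_swap_left]
      ring
    · intro a b e
      simp only [K]
      rw [triExpo_swap_right]
      ring
    · intro p q hpq
      have hs : ∃ s : Expo 3 6, (s : Fin 3 →₀ ℕ) 0 = p ∧ (s : Fin 3 →₀ ℕ) 1 = q := by
        refine ⟨⟨Finsupp.equivFunOnFinite.symm ![p, q, 6 - p - q], ?_⟩, rfl, rfl⟩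
        rw [mem_finsuppAntidiag_univ_iff, Finsupp.degree_eq_sum, Fin.sum_univ_three]
        simp
        omega
      obtain ⟨s, rfl, rfl⟩ := hs
      have h := hD (Sum.elim 0 (Pi.single s 1))
      have hq : ∀ a, paramQuad (Sum.elim 0 (Pi.single s 1)) a = 0 := by
        intro a
        simp [paramQuad, quadForm]
      simp only [hq, mul_zero, zero_mul, add_zero, map_zero, paramFun_nuPoly_mul, Sum.elim_inr,
        Pi.single_apply] at h
      refine Eq.trans ?_ h
      refine Finset.sum_congr rfl fun a _ => Finset.sum_congr rfl fun b _ =>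
        Finset.sum_congr rfl fun e _ => ?_
      simp only [veroneseTriExpo_eq_iff, K]
      split_ifs <;> ring
    · intro i j
      have h := congrArg (veroneseCoeff i * ·) (hA i j)
      simp only [paramFun_baseParam, mul_zero, Finset.mul_sum] at h
      refine (mul_eq_zero.1 (Eq.trans ?_ h)).resolve_right (veroneseCoeff_ne_zero j)
      rw [Finset.sum_mul]
      refine Finset.sum_congr rfl fun b _ => ?_
      rw [Finset.sum_mul]
      refine Finset.sum_congr rfl fun e _ => ?_
      simp only [K]
      split_ifs <;> ring
    · simp [K, (hk0 _).2 h035]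
  funext d
  obtain ⟨⟨a, b, e⟩, rfl⟩ := exists_triExpo_eq d
  refine (hk0 _).1 ((mul_eq_zero.1 (hK a b e)).resolve_left ?_)
  exact mul_ne_zero (mul_ne_zero (veroneseCoeff_ne_zero a) (veroneseCoeff_ne_zero b))
    (veroneseCoeff_ne_zero e)

/-- No polynomial relation between the parametrized coordinates omits the coordinate at
`triExpo 0 3 5`. -/
theorem eq_zero_of_rename_vanishes {Q : MvPolynomial {d : Expo 6 3 // d ≠ triExpo 0 3 5} ℂ}
    (hQ : ∀ x, eval (fun d => eval x (cubicParam d)) (rename Subtype.val Q) = 0) : Q = 0 := by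
  classical
  refine MvPolynomial.eq_zero_of_submersion (E := Param → ℂ)
    (F := fun x d => eval x (cubicParam d.1)) (x₀ := baseParam) ?_ ?_
    (Filter.Eventually.of_forall fun x => ?_)
  · exact (contDiff_pi.2 fun d => contDiff_eval_mvPolynomial _).contDiffAt
  · intro c hc
    let c' : Expo 6 3 → ℂ := fun d => if h : d ≠ triExpo 0 3 5 then c ⟨d, h⟩ else 0
    have hsum : ∀ φ : Expo 6 3 → ℂ, ∑ d, c' d * φ d =
        ∑ i : {d : Expo 6 3 // d ≠ triExpo 0 3 5}, c i * φ i.1 := by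
      intro φ
      have h1 : ∀ i : {d : Expo 6 3 // d ≠ triExpo 0 3 5}, c i * φ i.1 = c' i.1 * φ i.1 := by
        intro i
        simp only [c', dif_pos i.2]
      rw [Finset.sum_congr rfl fun i _ => h1 i]
      rw [← Finset.sum_subtype (Finset.univ.filter fun d => d ≠ triExpo 0 3 5) (by simp)
        fun d => c' d * φ d, Finset.sum_filter_of_ne]
      intro d _ hd hd'
      simp [c', hd'] at hd
    have hc' : c' = 0 := by
      refine eq_zero_of_deriv_cubicParam_eq_zero (by simp [c']) fun v => ?_
      simp only [hsum fun d => eval (baseParam + _ • v) (cubicParam d)]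
      exact hc v
    funext i
    have h := congrFun hc' i.1
    simp only [c', dif_pos i.2] at h
    exact h
  · have := hQ x
    rwa [eval_rename] at this

/-- The coordinates with respect to `nuPoly` of the quadratic form with matrix `Bᵀ D B`. -/
def congrDiag {R : Type*} [CommRing R] (B : Fin 3 → Fin 3 → R) (D : Fin 3 → R) (j : Fin 6) : R :=
  ∑ r, D r * B r (veroneseFst j) * B r (veroneseSnd j)

/-- The parameters whose first two quadratic forms are diagonalized simultaneously by `B`, the
first of them having the identity matrix in the new coordinates. -/
def congrParam {R : Type*} [CommRing R] (B : Fin 3 → Fin 3 → R) (D : Fin 3 → R)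
    (p : (Fin 4 × Fin 6) ⊕ Expo 3 6 → R) : Param → R :=
  Sum.elim (fun i => Matrix.vecCons (congrDiag B 1 i.2) (Matrix.vecCons (congrDiag B D i.2)
    fun a => p (.inl (a, i.2))) i.1) fun s => p (.inr s)

/-- The linear substitution with matrix `B` in ternary forms. -/
noncomputable def linSubst (B : Matrix (Fin 3) (Fin 3) ℂ) :
    MvPolynomial (Fin 3) ℂ →ₐ[ℂ] MvPolynomial (Fin 3) ℂ :=
  aeval fun r => ∑ s, B r s • X s

theorem eval_linSubst (B : Matrix (Fin 3) (Fin 3) ℂ) (w : Fin 3 → ℂ)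
    (g : MvPolynomial (Fin 3) ℂ) : eval w (linSubst B g) = eval (B.mulVec w) g := by
  rw [linSubst, eval_aeval_mvPolynomial]
  congr 2
  funext r
  simp [Matrix.mulVec, dotProduct, smul_eval]

theorem linSubst_linSubst_of_mul_eq_one {B B' : Matrix (Fin 3) (Fin 3) ℂ} (h : B' * B = 1)
    (g : MvPolynomial (Fin 3) ℂ) : linSubst B (linSubst B' g) = g :=
  MvPolynomial.funext fun w => by
    rw [eval_linSubst, eval_linSubst, Matrix.mulVec_mulVec, h, Matrix.one_mulVec]

theorem eval_quadForm (u : Fin 6 → ℂ) (w : Fin 3 → ℂ) :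
    eval w (quadForm u) = ∑ j, u j * nu w j := by
  simp [quadForm, eval_nuPoly, smul_eval]

theorem linSubst_quadForm_congrDiag (B : Matrix (Fin 3) (Fin 3) ℂ) (D : Fin 3 → ℂ) :
    linSubst B (quadForm (congrDiag (1 : Matrix (Fin 3) (Fin 3) ℂ) D)) =
      quadForm (congrDiag B D) :=
  MvPolynomial.funext fun w => by
    simp only [eval_linSubst, eval_quadForm, congrDiag, nu, Fin.sum_univ_succ, veroneseFst,
      veroneseSnd, Matrix.mulVec, dotProduct, Matrix.one_apply]
    simp
    ring

theorem X_mul_X_mem_span_nuPoly (r s : Fin 3) :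
    X r * X s ∈ Submodule.span ℂ (Set.range nuPoly) := by
  obtain ⟨j, hj⟩ : ∃ j, (veroneseFst j = r ∧ veroneseSnd j = s) ∨
      (veroneseFst j = s ∧ veroneseSnd j = r) := by
    revert r s
    decide
  have h : X r * X s = (veroneseCoeff j)⁻¹ • nuPoly j := by
    rw [nuPoly_eq, smul_smul, inv_mul_cancel₀ (veroneseCoeff_ne_zero j), one_smul]
    rcases hj with ⟨rfl, rfl⟩ | ⟨rfl, rfl⟩
    · rfl
    · exact mul_comm _ _
  rw [h]
  exact Submodule.smul_mem _ _ (Submodule.subset_span ⟨j, rfl⟩)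

theorem exists_quadForm_eq_linSubst (B : Matrix (Fin 3) (Fin 3) ℂ) (u : Fin 6 → ℂ) :
    ∃ u', quadForm u' = linSubst B (quadForm u) := by
  refine (Submodule.mem_span_range_iff_exists_fun ℂ).1 ?_
  rw [quadForm, map_sum]
  refine Submodule.sum_mem _ fun j _ => ?_
  rw [map_smul, nuPoly_eq, map_smul, map_mul, linSubst, aeval_X, aeval_X, Finset.sum_mul_sum]
  refine Submodule.smul_mem _ _ (Submodule.smul_mem _ _ (Submodule.sum_mem _ fun r _ =>
    Submodule.sum_mem _ fun s _ => ?_))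
  rw [smul_mul_smul_comm]
  exact Submodule.smul_mem _ _ (X_mul_X_mem_span_nuPoly r s)

/-- A linear change of the ternary coordinates does not change the parametrized cubic form. -/
theorem exists_eval_cubicParam_congrParam_eq {B : Matrix (Fin 3) (Fin 3) ℂ} (hB : IsUnit B.det)
    (D : Fin 3 → ℂ) (p : (Fin 4 × Fin 6) ⊕ Expo 3 6 → ℂ) :
    ∃ p', ∀ d, eval (congrParam B D p) (cubicParam d) =
      eval (congrParam (1 : Matrix (Fin 3) (Fin 3) ℂ) D p') (cubicParam d) := by
  choose u hu using fun a : Fin 4 => exists_quadForm_eq_linSubst B⁻¹ fun j => p (.inl (a, j))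
  set x := congrParam B D p with hx
  let Λ := (paramFun x).comp (linSubst B).toLinearMap
  refine ⟨Sum.elim (fun i => u i.1 i.2) fun s => Λ (monomial (s : Fin 3 →₀ ℕ) 1), fun d => ?_⟩
  set x' := congrParam (1 : Matrix (Fin 3) (Fin 3) ℂ) D
    (Sum.elim (fun i => u i.1 i.2) fun s => Λ (monomial (s : Fin 3 →₀ ℕ) 1)) with hx'
  have hq : ∀ a, paramQuad x a = linSubst B (paramQuad x' a) := by
    intro a
    refine Fin.cases ?_ (fun a => Fin.cases ?_ (fun a => ?_) a) a
    · exact (linSubst_quadForm_congrDiag B 1).symm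
    · exact (linSubst_quadForm_congrDiag B D).symm
    · have h : paramQuad x' a.succ.succ = quadForm (u a) := rfl
      rw [h, hu, linSubst_linSubst_of_mul_eq_one (Matrix.nonsing_inv_mul B hB)]
      rfl
  obtain ⟨⟨a, b, c⟩, rfl⟩ := exists_triExpo_eq d
  rw [eval_cubicParam_triExpo, eval_cubicParam_triExpo, hq, hq, hq, ← map_mul, ← map_mul]
  exact (paramFun_eq_of_isHomogeneous (x := x') (Λ := Λ) (fun s => rfl)
    (quadForm_mul_isHomogeneous _ _ _)).symm

/-- The parametrized coordinates satisfy a polynomial relation over the slice of simultaneously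
diagonal parameters. -/
theorem exists_ne_zero_vanishing_on_diagonal : ∃ P : MvPolynomial (Expo 6 3) ℂ, P ≠ 0 ∧
    ∀ (D : Fin 3 → ℂ) (p : (Fin 4 × Fin 6) ⊕ Expo 3 6 → ℂ),
      eval (fun d => eval (congrParam (1 : Matrix (Fin 3) (Fin 3) ℂ) D p) (cubicParam d)) P = 0 := by
  let T := Fin 3 ⊕ ((Fin 4 × Fin 6) ⊕ Expo 3 6)
  let θ : Param → MvPolynomial T ℂ := congrParam (1 : Matrix (Fin 3) (Fin 3) (MvPolynomial T ℂ))
    (fun r => X (.inl r)) fun i => X (.inr i)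
  have hdep : ¬ AlgebraicIndependent ℂ fun d : Expo 6 3 => aeval θ (cubicParam d) := by
    intro h
    have h1 := h.cardinalMk_le_trdeg
    rw [MvPolynomial.trdeg_of_isDomain, Cardinal.mk_fintype, Cardinal.mk_fintype, card_expo] at h1
    simp only [T, Fintype.card_sum, Fintype.card_prod, Fintype.card_fin, card_expo,
      Cardinal.lift_natCast, Nat.cast_le] at h1
    revert h1
    decide
  rw [algebraicIndependent_iff] at hdep
  push Not at hdep
  obtain ⟨P, hP, hP0⟩ := hdep
  refine ⟨P, hP0, fun D p => ?_⟩
  have h := congrArg (eval (Sum.elim D p)) hP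
  rw [eval_aeval_mvPolynomial, map_zero] at h
  rw [← h]
  congr 2
  funext d
  rw [eval_aeval_mvPolynomial]
  congr 2
  funext i
  rcases i with ⟨a, j⟩ | s
  · refine Fin.cases ?_ (fun a => Fin.cases ?_ (fun a => ?_) a) a
    · simp [θ, congrParam, congrDiag, Matrix.one_apply]
    · simp [θ, congrParam, congrDiag, Matrix.one_apply, apply_ite (eval (Sum.elim D p))]
    · simp [θ, congrParam]
  · simp [θ, congrParam]

theorem sum_param (φ : Param → ℂ) : ∑ i, φ i = ∑ j, φ (.inl (0, j)) + ∑ j, φ (.inl (1, j)) +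
    (∑ a : Fin 4, ∑ j, φ (.inl (a.succ.succ, j))) + ∑ s, φ (.inr s) := by
  rw [Fintype.sum_sum_type, Fintype.sum_prod_type,
    Fin.sum_univ_succ fun a : Fin 6 => ∑ j, φ (.inl (a, j)),
    Fin.sum_univ_succ fun a : Fin 5 => ∑ j, φ (.inl (a.succ, j)), ← add_assoc]
  rfl

theorem hasDerivAt_congrDiag (B' : Fin 3 → Fin 3 → ℂ) (D D' : Fin 3 → ℂ) (j : Fin 6) :
    HasDerivAt (fun t : ℂ => congrDiag
        (fun r s => (if r = s then 1 else 0) + t * B' r s) (fun r => D r + t * D' r) j)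
      ((if veroneseFst j = veroneseSnd j then D' (veroneseFst j) else 0) +
        D (veroneseSnd j) * B' (veroneseSnd j) (veroneseFst j) +
        D (veroneseFst j) * B' (veroneseFst j) (veroneseSnd j)) 0 := by
  have hline : ∀ z z' : ℂ, HasDerivAt (fun t : ℂ => z + t * z') z' 0 := by
    intro z z'
    simpa using ((hasDerivAt_id' (0 : ℂ)).mul_const z').const_add z
  have h := HasDerivAt.fun_sum (u := Finset.univ) fun (r : Fin 3) _ =>
    ((hline (D r) (D' r)).fun_mul (hline (if r = veroneseFst j then 1 else 0)
      (B' r (veroneseFst j)))).fun_mul (hline (if r = veroneseSnd j then 1 else 0)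
      (B' r (veroneseSnd j)))
  refine h.congr_deriv ?_
  simp only [zero_mul, add_zero, mul_ite, ite_mul, mul_one, mul_zero, Finset.sum_add_distrib,
    Finset.sum_ite_eq', Finset.mem_univ, if_true, eq_comm]
  split_ifs with hj
  · rw [hj]
  · rfl

/-- A polynomial in the parameters vanishing at all parameters whose first two quadratic forms
are simultaneously diagonalizable is zero. -/
theorem eq_zero_of_eval_congrParam_eq_zero {Q : MvPolynomial Param ℂ}
    (hQ : ∀ (B : Matrix (Fin 3) (Fin 3) ℂ) (D : Fin 3 → ℂ) (p : (Fin 4 × Fin 6) ⊕ Expo 3 6 → ℂ),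
      IsUnit B.det → eval (congrParam B D p) Q = 0) : Q = 0 := by
  let x₀ : (Fin 3 → Fin 3 → ℂ) × (Fin 3 → ℂ) × ((Fin 4 × Fin 6) ⊕ Expo 3 6 → ℂ) :=
    (fun r s => if r = s then 1 else 0, ![0, 1, 2], 0)
  refine MvPolynomial.eq_zero_of_submersion (F := fun x => congrParam x.1 x.2.1 x.2.2) (x₀ := x₀)
    ?_ ?_ ?_
  · refine contDiffAt_pi.2 fun i => ?_
    rcases i with ⟨a, j⟩ | s
    · refine Fin.cases ?_ (fun a => Fin.cases ?_ (fun a => ?_) a) a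
      · simp only [congrParam, congrDiag, Sum.elim_inl, Matrix.cons_val_zero]
        fun_prop
      · simp only [congrParam, congrDiag, Sum.elim_inl, Matrix.cons_val_succ, Matrix.cons_val_zero]
        fun_prop
      · simp only [congrParam, Sum.elim_inl, Matrix.cons_val_succ]
        fun_prop
    · simp only [congrParam, Sum.elim_inr]
      fun_prop
  · intro c hc
    have hD : ∀ (B' : Fin 3 → Fin 3 → ℂ) (D' : Fin 3 → ℂ) (p' : (Fin 4 × Fin 6) ⊕ Expo 3 6 → ℂ),
        (∑ j, c (.inl (0, j)) * (B' (veroneseSnd j) (veroneseFst j) +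
            B' (veroneseFst j) (veroneseSnd j))) +
        (∑ j, c (.inl (1, j)) * ((if veroneseFst j = veroneseSnd j then D' (veroneseFst j) else 0) +
          ![0, 1, 2] (veroneseSnd j) * B' (veroneseSnd j) (veroneseFst j) +
          ![0, 1, 2] (veroneseFst j) * B' (veroneseFst j) (veroneseSnd j))) +
        (∑ a : Fin 4, ∑ j, c (.inl (a.succ.succ, j)) * p' (.inl (a, j))) +
        ∑ s, c (.inr s) * p' (.inr s) = 0 := by
      intro B' D' p'
      refine Eq.trans (HasDerivAt.deriv ?_).symm (hc (B', D', p'))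
      have hline : ∀ z z' : ℂ, HasDerivAt (fun t : ℂ => z * (t * z')) (z * z') 0 := by
        intro z z'
        simpa using ((hasDerivAt_id' (0 : ℂ)).mul_const z').const_mul z
      have h := (((HasDerivAt.fun_sum (u := Finset.univ) fun (j : Fin 6) _ =>
          (hasDerivAt_congrDiag B' 1 0 j).const_mul (c (.inl (0, j)))).fun_add
        (HasDerivAt.fun_sum (u := Finset.univ) fun (j : Fin 6) _ =>
          (hasDerivAt_congrDiag B' ![0, 1, 2] D' j).const_mul (c (.inl (1, j))))).fun_add
        (HasDerivAt.fun_sum (u := Finset.univ) fun (a : Fin 4) _ =>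
          HasDerivAt.fun_sum (u := Finset.univ) fun (j : Fin 6) _ =>
            hline (c (.inl (a.succ.succ, j))) (p' (.inl (a, j))))).fun_add
        (HasDerivAt.fun_sum (u := Finset.univ) fun (s : Expo 3 6) _ =>
          hline (c (.inr s)) (p' (.inr s)))
      refine (h.congr_deriv ?_).congr_of_eventuallyEq (Filter.Eventually.of_forall fun t => ?_)
      · simp
      · refine (sum_param _).trans (congrArg₂ _ (congrArg₂ _ (congrArg₂ _ ?_ rfl) ?_) ?_)
        · refine Finset.sum_congr rfl fun j _ => congrArg (c (.inl (0, j)) * ·) ?_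
          simp only [Pi.zero_apply, mul_zero, add_zero]
          rfl
        · exact Finset.sum_congr rfl fun a _ => Finset.sum_congr rfl fun j _ =>
            congrArg (c (.inl (a.succ.succ, j)) * ·) (zero_add _)
        · exact Finset.sum_congr rfl fun s _ => congrArg (c (.inr s) * ·) (zero_add _)
    have hfree : ∀ i : (Fin 4 × Fin 6) ⊕ Expo 3 6,
        c (Sum.map (fun q => (q.1.succ.succ, q.2)) id i) = 0 := by
      intro i
      have h := hD 0 0 (Pi.single i 1)
      rcases i with ⟨a, j⟩ | s
      · simpa [Pi.single_apply, ite_and] using h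
      · simpa [Pi.single_apply] using h
    have hB : ∀ r s, _ := fun r s => hD (fun r' s' => if r' = r ∧ s' = s then 1 else 0) 0 0
    have hE : ∀ r, _ := fun r => hD 0 (Pi.single r 1) 0
    simp only [Fin.sum_univ_six, veroneseFst, veroneseSnd] at hB hE
    have e0 := hE 0
    have e1 := hE 1
    have e2 := hE 2
    have b00 := hB 0 0
    have b01 := hB 0 1
    have b02 := hB 0 2
    have b10 := hB 1 0
    have b11 := hB 1 1
    have b12 := hB 1 2
    have b20 := hB 2 0
    have b21 := hB 2 1
    have b22 := hB 2 2
    clear hB hE hD hc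
    simp at e0 e1 e2 b00 b01 b02 b10 b11 b12 b20 b21 b22
    funext i
    rcases i with ⟨a, j⟩ | s
    · refine Fin.cases ?_ (fun a => Fin.cases ?_ (fun a => ?_) a) a
      · fin_cases j <;> simp <;> grind
      · fin_cases j <;> simp <;> grind
      · exact hfree (.inl (a, j))
    · exact hfree (.inr s)
  · have hcont : Continuous fun x : (Fin 3 → Fin 3 → ℂ) × (Fin 3 → ℂ) ×
        ((Fin 4 × Fin 6) ⊕ Expo 3 6 → ℂ) => (Matrix.of x.1).det := by
      exact (Continuous.matrix_det continuous_fst)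
    have hne : ∀ᶠ x in 𝓝 x₀, (Matrix.of x.1).det ≠ 0 :=
      hcont.continuousAt.eventually_ne (by
        have h1 : Matrix.of x₀.1 = (1 : Matrix (Fin 3) (Fin 3) ℂ) := by
          ext r s
          simp [x₀, Matrix.one_apply]
        simp [h1])
    filter_upwards [hne] with x hx
    exact hQ _ _ _ (isUnit_iff_ne_zero.2 hx)

/-- The parametrized coordinates satisfy a polynomial relation. -/
theorem exists_ne_zero_aeval_cubicParam_eq_zero :
    ∃ P : MvPolynomial (Expo 6 3) ℂ, P ≠ 0 ∧ aeval cubicParam P = 0 := by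
  obtain ⟨P, hP0, hP⟩ := exists_ne_zero_vanishing_on_diagonal
  refine ⟨P, hP0, eq_zero_of_eval_congrParam_eq_zero fun B D p hB => ?_⟩
  obtain ⟨p', hp'⟩ := exists_eval_cubicParam_congrParam_eq hB D p
  rw [eval_aeval_mvPolynomial]
  simp only [hp']
  exact hP D p'

/-- A polynomial relation between the parametrized coordinates holds identically. -/
theorem aeval_cubicParam_eq_zero_iff (P : MvPolynomial (Expo 6 3) ℂ) :
    aeval cubicParam P = 0 ↔ ∀ x, eval (fun d => eval x (cubicParam d)) P = 0 := by
  simp only [← eval_aeval_mvPolynomial]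
  exact ⟨fun h x => by rw [h, map_zero], fun h => MvPolynomial.funext fun x => by rw [h, map_zero]⟩

/-- It suffices to test a polynomial relation at the parameters with an invertible matrix. -/
theorem aeval_cubicParam_eq_zero_of_paramDet {P : MvPolynomial (Expo 6 3) ℂ}
    (h : ∀ x, eval x paramDet ≠ 0 → eval (fun d => eval x (cubicParam d)) P = 0) :
    aeval cubicParam P = 0 := by
  refine (mul_eq_zero.1 (?_ : paramDet * aeval cubicParam P = 0)).resolve_left
    paramDet_ne_zero
  refine MvPolynomial.funext fun x => ?_
  rw [map_mul, map_zero, eval_aeval_mvPolynomial]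
  by_cases hx : eval x paramDet = 0
  · rw [hx, zero_mul]
  · rw [h x hx, mul_zero]

/-- The ideal of relations between the parametrized coordinates is prime of height one. -/
theorem isHeightOnePrime_ker_aeval_cubicParam :
    IsHeightOnePrime (RingHom.ker (aeval cubicParam : MvPolynomial (Expo 6 3) ℂ →ₐ[ℂ] _)) := by
  have hprime := RingHom.ker_isPrime (aeval cubicParam : MvPolynomial (Expo 6 3) ℂ →ₐ[ℂ] _)
  refine ⟨hprime, ⟨⊥, Ideal.isPrime_bot, bot_lt_iff_ne_bot.2 fun h => ?_⟩, fun p q _ hq hpq => ?_⟩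
  · obtain ⟨P, hP0, hP⟩ := exists_ne_zero_aeval_cubicParam_eq_zero
    have hmem : P ∈ RingHom.ker (aeval cubicParam : MvPolynomial (Expo 6 3) ℂ →ₐ[ℂ] _) := hP
    rw [h] at hmem
    exact hP0 hmem
  · exact MvPolynomial.not_lt_of_rename_eq_zero (triExpo 0 3 5) hprime
      (fun Q hQ => eq_zero_of_rename_vanishes ((aeval_cubicParam_eq_zero_iff _).1 hQ)) hq hpq

/-- Ring isomorphisms preserve primes of height one. -/
theorem IsHeightOnePrime.comap_ringEquiv {R S : Type*} [CommRing R] [CommRing S] (ε : R ≃+* S)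
    {I : Ideal S} (hI : IsHeightOnePrime I) : IsHeightOnePrime (I.comap ε) := by
  obtain ⟨hprime, ⟨p, hp, hpI⟩, hchain⟩ := hI
  have hback : (I.comap ε).comap ε.symm = I := by
    ext
    simp only [Ideal.mem_comap, RingEquiv.apply_symm_apply]
  refine ⟨Ideal.IsPrime.comap ε, ⟨p.comap ε, Ideal.IsPrime.comap ε,
    ε.idealComapOrderIso.lt_iff_lt.2 hpI⟩, fun p q hp hq hpq hqI => ?_⟩
  refine hchain (p.comap ε.symm) (q.comap ε.symm) (Ideal.IsPrime.comap ε.symm)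
    (Ideal.IsPrime.comap ε.symm) (ε.symm.idealComapOrderIso.lt_iff_lt.2 hpq) ?_
  rw [← hback]
  exact ε.symm.idealComapOrderIso.lt_iff_lt.2 hqI

/-- **Corollary (codim1).** The cubic forms apolar to some Veronese surface form a
hypersurface `D_{V-ap}`: the vanishing ideal of this set is prime of height 1. -/
theorem statement12 :
    ∀ e : (homogeneousSubmodule (Fin 6) ℂ 3) ≃ₗ[ℂ] (Fin 56 → ℂ),
      IsHeightOnePrime (vanishingIdealOf (e ''
        {f : homogeneousSubmodule (Fin 6) ℂ 3 |
          ∃ A : (Matrix (Fin 6) (Fin 6) ℂ)ˣ,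
            ∀ k : MvPolynomial (Fin 6) ℂ, k.IsHomogeneous 3 →
              (∀ w' : Fin 3 → ℂ, eval ((A : Matrix (Fin 6) (Fin 6) ℂ).mulVec (nu w')) k = 0) →
              pairing (f : MvPolynomial (Fin 6) ℂ) k = 0})) := by
  intro e
  have hfin : FiniteDimensional ℂ (homogeneousSubmodule (Fin 6) ℂ 3) := e.symm.finiteDimensional
  have hrank : Module.finrank ℂ (homogeneousSubmodule (Fin 6) ℂ 3) =
      Module.finrank ℂ (Expo 6 3 → ℂ) := by
    rw [e.finrank_eq, Module.finrank_fintype_fun_eq_card, Module.finrank_fintype_fun_eq_card,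
      card_expo, Fintype.card_fin]
    rfl
  let E := LinearEquiv.ofInjectiveOfFinrankEq cubicCoords cubicCoords_injective hrank
  have hE : ∀ f, E f = cubicCoords f := fun f => rfl
  obtain ⟨ε, hε⟩ := MvPolynomial.exists_algEquiv_eval (E.symm.trans e)
  have hideal : vanishingIdealOf (e '' {f : homogeneousSubmodule (Fin 6) ℂ 3 |
      ∃ A : (Matrix (Fin 6) (Fin 6) ℂ)ˣ, ∀ k : MvPolynomial (Fin 6) ℂ, k.IsHomogeneous 3 →
        (∀ w' : Fin 3 → ℂ, eval ((A : Matrix (Fin 6) (Fin 6) ℂ).mulVec (nu w')) k = 0) →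
          pairing (f : MvPolynomial (Fin 6) ℂ) k = 0}) =
      (RingHom.ker (aeval cubicParam : MvPolynomial (Expo 6 3) ℂ →ₐ[ℂ] _)).comap ε.toRingEquiv := by
    ext P
    simp only [vanishingIdealOf, Submodule.mem_iInf, Set.forall_mem_image, Set.mem_ofPred_eq,
      exists_apolar_veronese_iff, RingHom.mem_ker]
    have hmem : P ∈ (RingHom.ker (aeval cubicParam : MvPolynomial (Expo 6 3) ℂ →ₐ[ℂ] _)).comap
        ε.toRingEquiv ↔ aeval cubicParam (ε P) = 0 := Iff.rfl
    rw [hmem]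
    constructor
    · intro h
      refine aeval_cubicParam_eq_zero_of_paramDet fun x hx => ?_
      rw [hε]
      refine h ⟨x, hx, ?_⟩
      exact E.apply_symm_apply _
    · rintro h f ⟨x, -, hf⟩
      have h1 := (aeval_cubicParam_eq_zero_iff _).1 h x
      rw [hε, ← hf, ← hE] at h1
      simpa using h1
  rw [hideal]
  exact isHeightOnePrime_ker_aeval_cubicParam.comap_ringEquiv ε.toRingEquiv
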